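/- For every μ ∈ ℝ, τ > 0, γ ∈ [0,1] and α ≥ 0, with Z a standard normal random variable, E[η_soft(μ + τZ, γατ)] = τ·[((μ − γατ)/τ)·Φ((μ − γατ)/τ) + φ((μ − γατ)/τ) − ((−μ − γατ)/τ)·Φ((−μ − γατ)/τ) − φ((−μ − γατ)/τ)]. -/

import Mathlib

noncomputable section

/-- Soft-thresholding operator. -/
def softThresh (x b : ℝ) : ℝ :=
  if x > b then x - b else if x < -b then x + b else 0

/-- Standard normal density `φ(z) = exp(−z²/2)/√(2π)`. -/
def gpdf (z : ℝ) : ℝ := Real.exp (-z ^ 2 / 2) / Real.sqrt (2 * Real.pi)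

/-- Standard normal cumulative distribution function `Φ(z) = ∫_{−∞}^z φ(x) dx`. -/
def gcdf (z : ℝ) : ℝ := ∫ x in Set.Iic z, gpdf x

/-- `T(z) = (1 + z²)Φ(−z) − zφ(z)`. -/
def Tfun (z : ℝ) : ℝ := (1 + z ^ 2) * gcdf (-z) - z * gpdf z

theorem gpdf_neg (z : ℝ) : gpdf (-z) = gpdf z := by
  simp [gpdf]

theorem integrable_gpdf : MeasureTheory.Integrable gpdf := by
  have h := (integrable_exp_neg_mul_sq (b := 1 / 2) (by norm_num)).div_const (√(2 * Real.pi))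
  convert h using 2 with z
  unfold gpdf
  ring_nf

theorem integrable_mul_gpdf : MeasureTheory.Integrable (fun z : ℝ => z * gpdf z) := by
  have h := (integrable_mul_exp_neg_mul_sq (b := 1 / 2) (by norm_num)).div_const
    (√(2 * Real.pi))
  convert h using 2 with z
  unfold gpdf
  ring_nf

theorem hasDerivAt_gpdf (z : ℝ) : HasDerivAt gpdf (-(z * gpdf z)) z := by
  have h : HasDerivAt (fun x : ℝ => -x ^ 2 / 2) (-z) z := by
    refine ((hasDerivAt_pow 2 z).neg.div_const 2).congr_deriv ?_
    simp only [Nat.cast_ofNat]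
    ring
  refine (h.exp.div_const (√(2 * Real.pi))).congr_deriv ?_
  unfold gpdf
  ring

theorem tendsto_gpdf_atBot : Filter.Tendsto gpdf Filter.atBot (nhds 0) :=
  MeasureTheory.tendsto_zero_of_hasDerivAt_of_integrableOn_Iic (a := 0)
    (fun z _ => hasDerivAt_gpdf z) integrable_mul_gpdf.neg.integrableOn
    integrable_gpdf.integrableOn

theorem setIntegral_Iic_mul_gpdf (c : ℝ) : ∫ z in Set.Iic c, z * gpdf z = -gpdf c := by
  have h := MeasureTheory.integral_Iic_of_hasDerivAt_of_tendsto' (a := c)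
    (fun z _ => hasDerivAt_gpdf z) integrable_mul_gpdf.neg.integrableOn tendsto_gpdf_atBot
  rw [MeasureTheory.integral_neg] at h
  linarith

theorem integrable_max_sub_mul_gpdf (c : ℝ) :
    MeasureTheory.Integrable (fun z : ℝ => max (c - z) 0 * gpdf z) := by
  have h := ((integrable_gpdf.const_mul c).sub integrable_mul_gpdf).indicator
    (measurableSet_Iic (a := c))
  refine h.congr (Filter.Eventually.of_forall fun z => ?_)
  by_cases hz : z ≤ c
  · simp [hz, sub_mul]
  · simp [hz, max_eq_right (sub_nonpos.2 (not_le.1 hz).le)]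

theorem integral_max_sub_mul_gpdf (c : ℝ) :
    ∫ z : ℝ, max (c - z) 0 * gpdf z = c * gcdf c + gpdf c := by
  have h : (fun z : ℝ => max (c - z) 0 * gpdf z) =
      (Set.Iic c).indicator (fun z => c * gpdf z - z * gpdf z) := by
    ext z
    by_cases hz : z ≤ c
    · simp [hz, sub_mul]
    · simp [hz, max_eq_right (sub_nonpos.2 (not_le.1 hz).le)]
  rw [h, MeasureTheory.integral_indicator measurableSet_Iic,
    MeasureTheory.integral_sub (integrable_gpdf.const_mul c).integrableOn
      integrable_mul_gpdf.integrableOn,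
    MeasureTheory.integral_const_mul, setIntegral_Iic_mul_gpdf, gcdf, sub_neg_eq_add]

theorem integrable_max_add_mul_gpdf (c : ℝ) :
    MeasureTheory.Integrable (fun z : ℝ => max (c + z) 0 * gpdf z) := by
  simpa [gpdf_neg] using (integrable_max_sub_mul_gpdf c).comp_neg

theorem integral_max_add_mul_gpdf (c : ℝ) :
    ∫ z : ℝ, max (c + z) 0 * gpdf z = c * gcdf c + gpdf c := by
  rw [← integral_max_sub_mul_gpdf,
    ← MeasureTheory.integral_neg_eq_self (fun z => max (c - z) 0 * gpdf z)]
  simp [gpdf_neg]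

theorem softThresh_eq_max_sub_max (x b : ℝ) (hb : 0 ≤ b) :
    softThresh x b = max (x - b) 0 - max (-x - b) 0 := by
  unfold softThresh
  split_ifs with h₁ h₂
  · rw [max_eq_left (by linarith), max_eq_right (by linarith)]; ring
  · rw [max_eq_right (by linarith), max_eq_left (by linarith)]; ring
  · rw [max_eq_right (by linarith), max_eq_right (by linarith)]; ring

/-- first moment of the soft-thresholded Gaussian
`E[η_soft(μ + τZ, γατ)]`. -/
theorem softThresh_first_moment (μ τ γ α : ℝ) (hτ : 0 < τ)
    (hγ0 : 0 ≤ γ) (hγ1 : γ ≤ 1) (hα : 0 ≤ α) :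
    (∫ z : ℝ, softThresh (μ + τ * z) (γ * α * τ) * gpdf z)
      = τ * (((μ - γ * α * τ) / τ) * gcdf ((μ - γ * α * τ) / τ)
          + gpdf ((μ - γ * α * τ) / τ)
          - ((-μ - γ * α * τ) / τ) * gcdf ((-μ - γ * α * τ) / τ)
          - gpdf ((-μ - γ * α * τ) / τ)) := by
  set b := γ * α * τ
  have hb0 : 0 ≤ b := by positivity
  have h : ∀ z : ℝ, softThresh (μ + τ * z) b * gpdf z =
      τ * (max ((μ - b) / τ + z) 0 * gpdf z - max ((-μ - b) / τ - z) 0 * gpdf z) := by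
    intro z
    have h₁ : max (μ + τ * z - b) 0 = τ * max ((μ - b) / τ + z) 0 := by
      rw [mul_max_of_nonneg _ _ hτ.le, mul_zero, mul_add, mul_div_cancel₀ _ hτ.ne']
      ring_nf
    have h₂ : max (-(μ + τ * z) - b) 0 = τ * max ((-μ - b) / τ - z) 0 := by
      rw [mul_max_of_nonneg _ _ hτ.le, mul_zero, mul_sub, mul_div_cancel₀ _ hτ.ne']
      ring_nf
    rw [softThresh_eq_max_sub_max _ _ hb0, h₁, h₂]
    ring
  simp_rw [h]
  rw [MeasureTheory.integral_const_mul,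
    MeasureTheory.integral_sub (integrable_max_add_mul_gpdf _) (integrable_max_sub_mul_gpdf _),
    integral_max_add_mul_gpdf, integral_max_sub_mul_gpdf]
  ring
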